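/- arXiv:0904.2309 — 4 statements merged into one kernel-verified Lean document; each statement's English description precedes it below -/
import Mathlib

section
/- Let Ω ⊂ ℝ^N be a bounded domain with C³ boundary, let F : S^N × ℝ^N × ℝ × closure(Ω) → ℝ be continuous, degenerate elliptic and satisfy (H4'), and let g ∈ C(∂Ω). If u is a bounded, upper semicontinuous viscosity subsolution of the generalized Dirichlet problem F(D²u, Du, u, x) = 0 in Ω with boundary data g, and u satisfies u(x) = limsup_{y→x, y∈Ω} u(y) for every x ∈ ∂Ω, then u ≤ g on ∂Ω. -/
open Metric Set Filter Topology

noncomputable section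

/-- Points of `ℝ^N`. -/
abbrev Euc (N : ℕ) : Type := EuclideanSpace ℝ (Fin N)

/-- `N × N` real matrices (the equations are tested on symmetric ones, and all notions below
are monotone in the positive-semidefinite order). -/
abbrev Mat (N : ℕ) : Type := Matrix (Fin N) (Fin N) ℝ

namespace Visc

variable {N : ℕ}

/-- The Hessian matrix of `φ` at `x`, via the second iterated Fréchet derivative. -/
def hessM (φ : Euc N → ℝ) (x : Euc N) : Mat N :=
  Matrix.of fun i j =>
    iteratedFDeriv ℝ 2 φ x ![EuclideanSpace.single i (1:ℝ), EuclideanSpace.single j (1:ℝ)]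

/-- The distance `d(x)` to the boundary `∂Ω`. -/
def bdist (Ω : Set (Euc N)) (x : Euc N) : ℝ := infDist x (frontier Ω)

/-- The signed distance to `∂Ω`, positive inside `Ω` and negative outside. -/
def sdist (Ω : Set (Euc N)) (x : Euc N) : ℝ := infDist x Ωᶜ - infDist x Ω

/-- A bounded `C^{1,1}` domain: the signed distance function is differentiable with a
Lipschitz continuous gradient on a neighborhood `{|sdist| < δ₀}` of the boundary. -/
def IsC11Domain (Ω : Set (Euc N)) : Prop :=
  IsOpen Ω ∧ Bornology.IsBounded Ω ∧ IsConnected Ω ∧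
    ∃ δ₀ : ℝ, 0 < δ₀ ∧ ∃ (g : Euc N → Euc N) (L : NNReal),
      LipschitzOnWith L g {x | |sdist Ω x| < δ₀} ∧
      ∀ x ∈ {x | |sdist Ω x| < δ₀}, HasGradientAt (sdist Ω) (g x) x

/-- A bounded domain with `C³` boundary: the signed distance function is `C³` on a
neighborhood of the boundary. -/
def IsC3Domain (Ω : Set (Euc N)) : Prop :=
  IsOpen Ω ∧ Bornology.IsBounded Ω ∧ IsConnected Ω ∧
    ∃ δ₀ : ℝ, 0 < δ₀ ∧ ContDiffOn ℝ 3 (sdist Ω) {x | |sdist Ω x| < δ₀}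

/-- Operator norm of a matrix, via the associated map on `ℝ^N`. -/
def matNorm (M : Mat N) : ℝ := ‖(Matrix.toEuclideanCLM (𝕜 := ℝ) M : Euc N →L[ℝ] Euc N)‖

/-- `G : S^N → ℝ` is Lipschitz continuous with constant `L`. -/
def MatLip (L : ℝ) (G : Mat N → ℝ) : Prop := ∀ X Y, |G X - G Y| ≤ L * matNorm (X - Y)

/-- `G : S^N → ℝ` is positively homogeneous of degree `1`. -/
def Homog1 (G : Mat N → ℝ) : Prop := ∀ t : ℝ, 0 < t → ∀ M, G (t • M) = t * G M

/-- Degenerate ellipticity for `G : S^N → ℝ`. -/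
def EllipM (G : Mat N → ℝ) : Prop := ∀ X Y : Mat N, (X - Y).PosSemidef → G X ≤ G Y

/-- Degenerate ellipticity for `G(M,p)`. -/
def Ellip2 (G : Mat N → Euc N → ℝ) : Prop :=
  ∀ X Y : Mat N, (X - Y).PosSemidef → ∀ p, G X p ≤ G Y p

/-- Degenerate ellipticity for `F(M,p,x)`. -/
def Ellip3 (F : Mat N → Euc N → Euc N → ℝ) : Prop :=
  ∀ X Y : Mat N, (X - Y).PosSemidef → ∀ p x, F X p x ≤ F Y p x

/-- Degenerate ellipticity for `F(M,p,r,x)`. -/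
def Ellip4 (F : Mat N → Euc N → ℝ → Euc N → ℝ) : Prop :=
  ∀ X Y : Mat N, (X - Y).PosSemidef → ∀ p r x, F X p r x ≤ F Y p r x

/-- `u` is a viscosity subsolution of `G(D²u, Du) ≤ 0` on the set `A`. -/
def SubSol2 (A : Set (Euc N)) (G : Mat N → Euc N → ℝ) (u : Euc N → ℝ) : Prop :=
  ∀ φ : Euc N → ℝ, ContDiff ℝ 2 φ → ∀ x₀ ∈ A,
    IsLocalMaxOn (fun x => u x - φ x) A x₀ →
      G (hessM φ x₀) (gradient φ x₀) ≤ 0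

/-- `w` is a viscosity supersolution of `G(D²w, Dw) ≥ η` on the set `A`
(relative extrema: this encodes supersolutions "up to the boundary" of `A`). -/
def SupSol2Ge (A : Set (Euc N)) (G : Mat N → Euc N → ℝ) (w : Euc N → ℝ) (η : ℝ) : Prop :=
  ∀ φ : Euc N → ℝ, ContDiff ℝ 2 φ → ∀ x₀ ∈ A,
    IsLocalMinOn (fun x => w x - φ x) A x₀ →
      η ≤ G (hessM φ x₀) (gradient φ x₀)

/-- `u` is a viscosity subsolution of `F(D²u, Du, u, x) = 0` on the set `A`. -/
def SubSol4 (A : Set (Euc N)) (F : Mat N → Euc N → ℝ → Euc N → ℝ) (u : Euc N → ℝ) : Prop :=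
  ∀ φ : Euc N → ℝ, ContDiff ℝ 2 φ → ∀ x₀ ∈ A,
    IsLocalMaxOn (fun x => u x - φ x) A x₀ →
      F (hessM φ x₀) (gradient φ x₀) (u x₀) x₀ ≤ 0

/-- `u` is a viscosity supersolution of `F(D²u, Du, u, x) = 0` on the set `A`. -/
def SupSol4 (A : Set (Euc N)) (F : Mat N → Euc N → ℝ → Euc N → ℝ) (u : Euc N → ℝ) : Prop :=
  ∀ φ : Euc N → ℝ, ContDiff ℝ 2 φ → ∀ x₀ ∈ A,
    IsLocalMinOn (fun x => u x - φ x) A x₀ →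
      0 ≤ F (hessM φ x₀) (gradient φ x₀) (u x₀) x₀

/-- `u` is a viscosity subsolution of the generalized Dirichlet problem
`F(D²u, Du, u, x) = 0` in `Ω`, `u = g` on `∂Ω` (relaxed boundary condition
`min(F, u − g) ≤ 0`). -/
def DirSub (Ω : Set (Euc N)) (F : Mat N → Euc N → ℝ → Euc N → ℝ)
    (g : Euc N → ℝ) (u : Euc N → ℝ) : Prop :=
  ∀ φ : Euc N → ℝ, ContDiff ℝ 2 φ → ∀ x₀ ∈ closure Ω,
    IsLocalMaxOn (fun x => u x - φ x) (closure Ω) x₀ →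
      (x₀ ∈ Ω → F (hessM φ x₀) (gradient φ x₀) (u x₀) x₀ ≤ 0) ∧
      (x₀ ∈ frontier Ω →
        min (F (hessM φ x₀) (gradient φ x₀) (u x₀) x₀) (u x₀ - g x₀) ≤ 0)

/-- `u` is a viscosity supersolution of the generalized Dirichlet problem
`F(D²u, Du, u, x) = 0` in `Ω`, `u = g` on `∂Ω` (relaxed boundary condition
`max(F, u − g) ≥ 0`). -/
def DirSup (Ω : Set (Euc N)) (F : Mat N → Euc N → ℝ → Euc N → ℝ)
    (g : Euc N → ℝ) (u : Euc N → ℝ) : Prop :=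
  ∀ φ : Euc N → ℝ, ContDiff ℝ 2 φ → ∀ x₀ ∈ closure Ω,
    IsLocalMinOn (fun x => u x - φ x) (closure Ω) x₀ →
      (x₀ ∈ Ω → 0 ≤ F (hessM φ x₀) (gradient φ x₀) (u x₀) x₀) ∧
      (x₀ ∈ frontier Ω →
        0 ≤ max (F (hessM φ x₀) (gradient φ x₀) (u x₀) x₀) (u x₀ - g x₀))

/-- `w` is a continuous viscosity solution of the state-constraints problem
`F(D²w, Dw, x) = c` in `Ω`, `F(D²w, Dw, x) ≥ c` on `∂Ω`. -/
def StateSol (Ω : Set (Euc N)) (F : Mat N → Euc N → Euc N → ℝ) (c : ℝ)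
    (w : Euc N → ℝ) : Prop :=
  ContinuousOn w (closure Ω) ∧
  (∀ φ : Euc N → ℝ, ContDiff ℝ 2 φ → ∀ x₀ ∈ Ω,
     IsLocalMaxOn (fun x => w x - φ x) Ω x₀ →
       F (hessM φ x₀) (gradient φ x₀) x₀ ≤ c) ∧
  (∀ φ : Euc N → ℝ, ContDiff ℝ 2 φ → ∀ x₀ ∈ closure Ω,
     IsLocalMinOn (fun x => w x - φ x) (closure Ω) x₀ →
       c ≤ F (hessM φ x₀) (gradient φ x₀) x₀)

/-- `u` is a continuous viscosity solution of the state-constraints problem for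
`F(D²u, Du, u, x) = 0`: solution in `Ω` and supersolution up to the boundary. -/
def StateSol4 (Ω : Set (Euc N)) (F : Mat N → Euc N → ℝ → Euc N → ℝ)
    (u : Euc N → ℝ) : Prop :=
  ContinuousOn u (closure Ω) ∧ SubSol4 Ω F u ∧
  (∀ φ : Euc N → ℝ, ContDiff ℝ 2 φ → ∀ x₀ ∈ closure Ω,
     IsLocalMinOn (fun x => u x - φ x) (closure Ω) x₀ →
       0 ≤ F (hessM φ x₀) (gradient φ x₀) (u x₀) x₀)

/-- `u` is locally bounded on `Ω`. -/
def LocBddOn (u : Euc N → ℝ) (Ω : Set (Euc N)) : Prop :=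
  ∀ x ∈ Ω, ∃ V ∈ 𝓝 x, ∃ C : ℝ, ∀ y ∈ V ∩ Ω, |u y| ≤ C

/-- `u` is Hölder continuous with exponent `α` and constant `C` on `s`. -/
def HolderOn (C α : ℝ) (s : Set (Euc N)) (u : Euc N → ℝ) : Prop :=
  ∀ x ∈ s, ∀ y ∈ s, |u x - u y| ≤ C * dist x y ^ α

/-- Assumption (H4'): for each `R > 0`, `F(M,p,u,x) ≤ 0` (for `|u| ≤ R`, `x ∈ closure Ω`)
implies `G̃_R(M) + K₁^R |p|^m − K₂^R ≤ 0`, with `G̃_R` Lipschitz continuous, degenerate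
elliptic and positively homogeneous of degree 1, and `m > 2` independent of `R`. -/
def H4p (Ω : Set (Euc N)) (F : Mat N → Euc N → ℝ → Euc N → ℝ) (m : ℝ) : Prop :=
  2 < m ∧ ∀ R : ℝ, 0 < R → ∃ (K₁ K₂ L : ℝ) (G : Mat N → ℝ),
    0 < K₁ ∧ 0 < K₂ ∧ 0 ≤ L ∧ MatLip L G ∧ EllipM G ∧ Homog1 G ∧
    ∀ (M : Mat N) (p : Euc N) (r : ℝ), ∀ x ∈ closure Ω,
      |r| ≤ R → F M p r x ≤ 0 → G M + K₁ * ‖p‖ ^ m - K₂ ≤ 0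

/-- Assumption (H4') for a nonlinearity `F(M,p,x)` with no `u` dependence. -/
def H4p3 (Ω : Set (Euc N)) (F : Mat N → Euc N → Euc N → ℝ) (m : ℝ) : Prop :=
  2 < m ∧ ∃ (K₁ K₂ L : ℝ) (G : Mat N → ℝ),
    0 < K₁ ∧ 0 < K₂ ∧ 0 ≤ L ∧ MatLip L G ∧ EllipM G ∧ Homog1 G ∧
    ∀ (M : Mat N) (p : Euc N), ∀ x ∈ closure Ω,
      F M p x ≤ 0 → G M + K₁ * ‖p‖ ^ m - K₂ ≤ 0

/-- Assumption (H5): strict monotonicity of `F` in the `u` variable. -/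
def H5 (Ω : Set (Euc N)) (F : Mat N → Euc N → ℝ → Euc N → ℝ) : Prop :=
  ∀ R : ℝ, 0 < R → ∃ γ : ℝ, 0 < γ ∧ ∀ x ∈ closure Ω, ∀ r s : ℝ,
    -R ≤ s → s ≤ r → r ≤ R → ∀ (p : Euc N) (M : Mat N),
      γ * (r - s) ≤ F M p r x - F M p s x

/-- The block matrix `diag(X, -Y)`. -/
def blockD (X Y : Mat N) : Matrix (Fin N ⊕ Fin N) (Fin N ⊕ Fin N) ℝ :=
  Matrix.fromBlocks X 0 0 (-Y)

/-- The block matrix `[[Id, -Id], [-Id, Id]]`. -/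
def Jmat (N : ℕ) : Matrix (Fin N ⊕ Fin N) (Fin N ⊕ Fin N) ℝ :=
  Matrix.fromBlocks 1 (-1) (-1) 1

/-- The matrix inequalities
`-Kε^{-2+α-2β} Id ≤ diag(X, -Y) ≤ Kε^{-2+α-2β} [[Id,-Id],[-Id,Id]] + Kε^{α-2β} Id`. -/
def MatIneq (K ε α β : ℝ) (X Y : Mat N) : Prop :=
  (blockD X Y + (K * ε ^ (-2 + α - 2 * β)) • (1 : Matrix (Fin N ⊕ Fin N) (Fin N ⊕ Fin N) ℝ)).PosSemidef ∧
  ((K * ε ^ (-2 + α - 2 * β)) • Jmat N + (K * ε ^ (α - 2 * β)) • (1 : Matrix (Fin N ⊕ Fin N) (Fin N ⊕ Fin N) ℝ)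
      - blockD X Y).PosSemidef

/-- Assumption (H6): the structure condition used in the comparison proof, with
Hölder exponent `α` and some `0 < β < α`. -/
def H6 (Ω : Set (Euc N)) (F : Mat N → Euc N → ℝ → Euc N → ℝ) (α : ℝ) : Prop :=
  ∃ β : ℝ, 0 < β ∧ β < α ∧ ∀ μ : ℝ, 0 < μ → μ < 1 → ∀ R K : ℝ, 0 < R → 0 < K →
    ∃ (mRK : ℝ → ℝ) (Cμ : ℝ), 0 ≤ Cμ ∧ Tendsto mRK (𝓝[>] 0) (𝓝 0) ∧
      ∀ ε : ℝ, 0 < ε → ∀ x ∈ closure Ω, ∀ y ∈ closure Ω, ∀ r : ℝ, |r| ≤ R →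
        ∀ (p q : Euc N) (X Y : Mat N), MatIneq K ε α β X Y →
          ‖p - q‖ ≤ K * ε * (1 + ‖p‖ + ‖q‖) → ‖p‖ + ‖q‖ ≤ K * ε ^ (α - 1 - β) →
          dist x y ≤ K * ε →
          F Y q r y - μ * F (μ⁻¹ • X) (μ⁻¹ • p) (μ⁻¹ * r) x ≤ mRK ((1 - μ) + Cμ * ε)

/-- The class `𝒫` of superquadratic growth functions. -/
structure ClassP (h : ℝ → ℝ) : Prop where
  nonneg : ∀ t : ℝ, 0 ≤ t → 0 ≤ h t
  contDiff : ContDiffOn ℝ 1 h (Ici 0)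
  convexOn : ConvexOn ℝ (Ici 0) h
  mono : MonotoneOn (fun t => h t / t ^ 2) (Ici 1)
  integrable : MeasureTheory.IntegrableOn (fun t => t / h t) (Ici 1)

/-- The integer translation vector associated to `k : Fin N → ℤ`. -/
def intVec (k : Fin N → ℤ) : Euc N :=
  (EuclideanSpace.equiv (Fin N) ℝ).symm (fun i => (k i : ℝ))

/-- `v` is `ℤ^N`-periodic. -/
def ZPeriodic (v : Euc N → ℝ) : Prop := ∀ (k : Fin N → ℤ) (y : Euc N), v (y + intVec k) = v y

/-- `v` is a `ℤ^N`-periodic continuous viscosity solution of the cell problem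
`F(D²v, Dv + p, y, x) = lam` in `ℝ^N`. -/
def CellSol (F : Mat N → Euc N → Euc N → Euc N → ℝ) (p x : Euc N) (lam : ℝ)
    (v : Euc N → ℝ) : Prop :=
  Continuous v ∧ ZPeriodic v ∧
  (∀ φ : Euc N → ℝ, ContDiff ℝ 2 φ → ZPeriodic φ → ∀ y₀ : Euc N,
     IsLocalMax (fun y => v y - φ y) y₀ →
       F (hessM φ y₀) (gradient φ y₀ + p) y₀ x ≤ lam) ∧
  (∀ φ : Euc N → ℝ, ContDiff ℝ 2 φ → ZPeriodic φ → ∀ y₀ : Euc N,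
     IsLocalMin (fun y => v y - φ y) y₀ →
       lam ≤ F (hessM φ y₀) (gradient φ y₀ + p) y₀ x)

/-- Spatial Hessian of a space-time test function. -/
def phess (φ : Euc N × ℝ → ℝ) (x : Euc N) (t : ℝ) : Mat N := hessM (fun y => φ (y, t)) x

/-- Spatial gradient of a space-time test function. -/
def pgrad (φ : Euc N × ℝ → ℝ) (x : Euc N) (t : ℝ) : Euc N := gradient (fun y => φ (y, t)) x

/-- Time derivative of a space-time test function. -/
def ptd (φ : Euc N × ℝ → ℝ) (x : Euc N) (t : ℝ) : ℝ := deriv (fun s => φ (x, s)) t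

/-- Viscosity subsolution of the parabolic problem `u_t + F(D²u, Du, x) = 0` in
`Ω × (0,∞)` with the generalized Dirichlet condition `u = g` on `∂Ω × (0,∞)`. -/
def ParaDirSub (Ω : Set (Euc N)) (F : Mat N → Euc N → Euc N → ℝ) (g : Euc N → ℝ)
    (u : Euc N → ℝ → ℝ) : Prop :=
  ∀ φ : Euc N × ℝ → ℝ, ContDiff ℝ 2 φ → ∀ (x₀ : Euc N) (t₀ : ℝ), x₀ ∈ closure Ω → 0 < t₀ →
    IsLocalMaxOn (fun q : Euc N × ℝ => u q.1 q.2 - φ q) (closure Ω ×ˢ Ioi (0:ℝ)) (x₀, t₀) →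
      (x₀ ∈ Ω → ptd φ x₀ t₀ + F (phess φ x₀ t₀) (pgrad φ x₀ t₀) x₀ ≤ 0) ∧
      (x₀ ∈ frontier Ω →
        min (ptd φ x₀ t₀ + F (phess φ x₀ t₀) (pgrad φ x₀ t₀) x₀) (u x₀ t₀ - g x₀) ≤ 0)

/-- Viscosity supersolution of the parabolic problem `u_t + F(D²u, Du, x) = 0` in
`Ω × (0,∞)` with the generalized Dirichlet condition `u = g` on `∂Ω × (0,∞)`. -/
def ParaDirSup (Ω : Set (Euc N)) (F : Mat N → Euc N → Euc N → ℝ) (g : Euc N → ℝ)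
    (u : Euc N → ℝ → ℝ) : Prop :=
  ∀ φ : Euc N × ℝ → ℝ, ContDiff ℝ 2 φ → ∀ (x₀ : Euc N) (t₀ : ℝ), x₀ ∈ closure Ω → 0 < t₀ →
    IsLocalMinOn (fun q : Euc N × ℝ => u q.1 q.2 - φ q) (closure Ω ×ˢ Ioi (0:ℝ)) (x₀, t₀) →
      (x₀ ∈ Ω → 0 ≤ ptd φ x₀ t₀ + F (phess φ x₀ t₀) (pgrad φ x₀ t₀) x₀) ∧
      (x₀ ∈ frontier Ω →
        0 ≤ max (ptd φ x₀ t₀ + F (phess φ x₀ t₀) (pgrad φ x₀ t₀) x₀) (u x₀ t₀ - g x₀))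

/-- `u` is a solution of the Cauchy–Dirichlet problem for `u_t + F(D²u,Du,x)=0`
with initial and boundary data `u₀`. -/
def CauchyDirSol (Ω : Set (Euc N)) (F : Mat N → Euc N → Euc N → ℝ) (u₀ : Euc N → ℝ)
    (u : Euc N → ℝ → ℝ) : Prop :=
  ContinuousOn (fun q : Euc N × ℝ => u q.1 q.2) (closure Ω ×ˢ Ici (0:ℝ)) ∧
  (∀ x ∈ closure Ω, u x 0 = u₀ x) ∧
  ParaDirSub Ω F u₀ u ∧ ParaDirSup Ω F u₀ u

end Visc

namespace Visc

variable {N : ℕ}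

lemma continuous_sdist (Ω : Set (Euc N)) : Continuous (sdist Ω) :=
  (continuous_infDist_pt _).sub (continuous_infDist_pt _)

lemma sdist_nonneg_of_mem_closure {Ω : Set (Euc N)} {x : Euc N} (hx : x ∈ closure Ω) :
    0 ≤ sdist Ω x := by
  rw [sdist, infDist_zero_of_mem_closure hx, sub_zero]
  exact infDist_nonneg

lemma sdist_eq_zero_of_mem_frontier {Ω : Set (Euc N)} {x : Euc N} (hx : x ∈ frontier Ω) :
    sdist Ω x = 0 := by
  rw [frontier_eq_closure_inter_closure] at hx
  rw [sdist, infDist_zero_of_mem_closure hx.1, infDist_zero_of_mem_closure hx.2, sub_zero]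

/-- The signed distance has a derivative of norm at least one at interior points. -/
lemma one_le_norm_fderiv_sdist {Ω : Set (Euc N)} (hΩ : IsOpen Ω) (hne : Ωᶜ.Nonempty)
    {x : Euc N} (hx : x ∈ Ω) (hd : DifferentiableAt ℝ (sdist Ω) x) :
    1 ≤ ‖fderiv ℝ (sdist Ω) x‖ := by
  obtain ⟨y, hy, hxy⟩ := hΩ.isClosed_compl.exists_infDist_eq_dist hne x
  have hpos : 0 < ‖y - x‖ := norm_pos_iff.2 (sub_ne_zero.2 fun h => hy (h ▸ hx))
  have hsx : sdist Ω x = ‖y - x‖ := by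
    rw [sdist, infDist_zero_of_mem hx, sub_zero, hxy, dist_comm, dist_eq_norm]
  have hle : ∀ t : ℝ, t ≤ 1 → sdist Ω (x + t • (y - x)) ≤ (1 - t) * ‖y - x‖ := by
    intro t ht
    have h1 : dist (x + t • (y - x)) y = (1 - t) * ‖y - x‖ := by
      have h2 : x + t • (y - x) - y = -((1 - t) • (y - x)) := by module
      rw [dist_eq_norm, h2, norm_neg, norm_smul, Real.norm_of_nonneg (by linarith)]
    have h3 : infDist (x + t • (y - x)) Ωᶜ ≤ dist (x + t • (y - x)) y := infDist_le_dist_of_mem hy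
    have h4 : 0 ≤ infDist (x + t • (y - x)) Ω := infDist_nonneg
    rw [sdist]
    linarith
  have hline : HasDerivAt (fun t : ℝ => x + t • (y - x)) (y - x) 0 := by
    simpa using ((hasDerivAt_id (0 : ℝ)).smul_const (y - x)).const_add x
  have hcomp : HasDerivAt (fun t : ℝ => sdist Ω (x + t • (y - x)))
      (fderiv ℝ (sdist Ω) x (y - x)) 0 :=
    HasFDerivAt.comp_hasDerivAt_of_eq (0 : ℝ) hd.hasFDerivAt hline (by simp)
  have hlin : HasDerivAt (fun t : ℝ => (1 - t) * ‖y - x‖) (-‖y - x‖) 0 := by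
    simpa using ((hasDerivAt_id (0 : ℝ)).const_sub 1).mul_const ‖y - x‖
  have hmax : IsLocalMax
      (fun t : ℝ => sdist Ω (x + t • (y - x)) - (1 - t) * ‖y - x‖) 0 := by
    filter_upwards [Iio_mem_nhds (zero_lt_one (α := ℝ))] with t ht
    have := hle t ht.le
    simp only [zero_smul, add_zero, hsx, sub_zero, one_mul, sub_self]
    linarith
  have h0 := hmax.hasDerivAt_eq_zero (hcomp.sub hlin)
  have hop := (fderiv ℝ (sdist Ω) x).le_opNorm (y - x)
  have habs := neg_le_abs (fderiv ℝ (sdist Ω) x (y - x))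
  rw [Real.norm_eq_abs] at hop
  exact le_of_mul_le_mul_right (by linarith) hpos

/-- At a boundary point of a `C³` domain there is an interior normal of norm at least one. -/
lemma exists_inner_normal {Ω : Set (Euc N)} (hΩ : IsC3Domain Ω) {x : Euc N}
    (hx : x ∈ frontier Ω) :
    ∃ n : Euc N, 1 ≤ ‖n‖ ∧ ∀ θ : ℝ, 0 < θ → ∃ r : ℝ, 0 < r ∧
      ∀ y ∈ closure Ω, ‖y - x‖ < r → -(θ * ‖y - x‖) ≤ inner ℝ n (y - x) := by
  obtain ⟨hopen, -, -, δ, hδ, hC⟩ := hΩ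
  have hUopen : IsOpen {x | |sdist Ω x| < δ} :=
    isOpen_lt (continuous_sdist Ω).abs continuous_const
  have hxU : x ∈ {x | |sdist Ω x| < δ} := by
    simpa [sdist_eq_zero_of_mem_frontier hx] using hδ
  have hne : Ωᶜ.Nonempty := ⟨x, by rw [hopen.frontier_eq] at hx; exact hx.2⟩
  have hdiff := hC.differentiableOn (by norm_num)
  have hcont := (hC.continuousOn_fderiv_of_isOpen hUopen (by norm_num)).continuousAt
    (hUopen.mem_nhds hxU)
  have hnorm : 1 ≤ ‖fderiv ℝ (sdist Ω) x‖ := by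
    have : (𝓝[Ω] x).NeBot := mem_closure_iff_nhdsWithin_neBot.1 (frontier_subset_closure hx)
    refine ge_of_tendsto (hcont.norm.tendsto.mono_left (nhdsWithin_le_nhds (s := Ω))) ?_
    filter_upwards [self_mem_nhdsWithin, mem_nhdsWithin_of_mem_nhds (hUopen.mem_nhds hxU)]
      with z hz hzU
    exact one_le_norm_fderiv_sdist hopen hne hz (hdiff.differentiableAt (hUopen.mem_nhds hzU))
  refine ⟨(InnerProductSpace.toDual ℝ (Euc N)).symm (fderiv ℝ (sdist Ω) x), by simpa using hnorm,
    fun θ hθ => ?_⟩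
  have hfd := (hdiff.differentiableAt (hUopen.mem_nhds hxU)).hasFDerivAt
  obtain ⟨r, hr, hball⟩ := Metric.eventually_nhds_iff.1 (hfd.isLittleO.def hθ)
  refine ⟨r, hr, fun y hy hyr => ?_⟩
  have h1 := hball (show dist y x < r by rwa [dist_eq_norm])
  rw [sdist_eq_zero_of_mem_frontier hx, Real.norm_eq_abs] at h1
  have h2 := (abs_le.1 h1).2
  have h3 := sdist_nonneg_of_mem_closure hy
  rw [InnerProductSpace.toDual_symm_apply]
  linarith

/-- The quadratic polynomial centred at `x` with gradient `p` at `x` and Hessian `2 a`. -/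
def quadTest (p x : Euc N) (a : ℝ) (y : Euc N) : ℝ := inner ℝ p (y - x) + a * ‖y - x‖ ^ 2

lemma contDiff_quadTest (p x : Euc N) (a : ℝ) : ContDiff ℝ 2 (quadTest p x a) := by
  unfold quadTest
  exact (contDiff_const.inner ℝ (contDiff_id.sub contDiff_const)).add
    (contDiff_const.mul ((contDiff_id.sub contDiff_const).norm_sq ℝ))

lemma hasFDerivAt_quadTest (p x : Euc N) (a : ℝ) (y : Euc N) :
    HasFDerivAt (quadTest p x a) (innerSL ℝ (p + (2 * a) • (y - x))) y := by
  have h0 : HasFDerivAt (fun z : Euc N => z - x) (ContinuousLinearMap.id ℝ (Euc N)) y :=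
    (hasFDerivAt_id y).sub_const x
  have h1 : HasFDerivAt (fun z : Euc N => innerSL ℝ p (z - x))
      ((innerSL ℝ p).comp (ContinuousLinearMap.id ℝ (Euc N))) y :=
    (innerSL ℝ p).hasFDerivAt.comp y h0
  have h2 := (h0.norm_sq).const_mul a
  refine (h1.add h2).congr_fderiv ?_
  ext z
  simp
  ring

lemma gradient_quadTest (p x : Euc N) (a : ℝ) (y : Euc N) :
    gradient (quadTest p x a) y = p + (2 * a) • (y - x) := by
  refine HasGradientAt.gradient ?_
  rw [hasGradientAt_iff_hasFDerivAt]
  exact hasFDerivAt_quadTest p x a y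

lemma hessM_quadTest (p x : Euc N) (a : ℝ) (y : Euc N) :
    hessM (quadTest p x a) y = (2 * a) • (1 : Mat N) := by
  have h1 : fderiv ℝ (quadTest p x a) = fun z => innerSL ℝ (p + (2 * a) • (z - x)) :=
    funext fun z => (hasFDerivAt_quadTest p x a z).fderiv
  have h2 : HasFDerivAt (fun z : Euc N => p + (2 * a) • (z - x))
      ((2 * a) • ContinuousLinearMap.id ℝ (Euc N)) y :=
    (((hasFDerivAt_id y).sub_const x).const_smul (2 * a)).const_add p
  have h3 : HasFDerivAt (fun z : Euc N => innerSL ℝ (p + (2 * a) • (z - x)))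
      ((innerSL ℝ (E := Euc N)).comp ((2 * a) • ContinuousLinearMap.id ℝ (Euc N))) y :=
    (innerSL ℝ (E := Euc N)).hasFDerivAt.comp y h2
  ext i j
  simp only [hessM, Matrix.of_apply, iteratedFDeriv_two_apply, h1, h3.fderiv]
  change inner ℝ ((2 * a) • EuclideanSpace.single i (1 : ℝ)) (EuclideanSpace.single j (1 : ℝ)) = _
  rw [inner_smul_left, EuclideanSpace.inner_single_left]
  simp [Matrix.one_apply]

end Visc

open Visc in
/-- Proposition 3.1 of Barles.
For a superquadratic equation (assumption (H4')), any bounded usc viscosity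
subsolution of the generalized Dirichlet problem, normalized on the boundary by
`u(x) = limsup_{y → x, y ∈ Ω} u(y)`, satisfies `u ≤ g` on `∂Ω`. -/
theorem subsolution_below_boundary_data
    {N : ℕ} (Ω : Set (Euc N)) (hΩ : IsC3Domain Ω)
    (F : Mat N → Euc N → ℝ → Euc N → ℝ)
    (hFcont : ContinuousOn
      (fun q : Mat N × Euc N × ℝ × Euc N => F q.1 q.2.1 q.2.2.1 q.2.2.2)
      (univ ×ˢ univ ×ˢ univ ×ˢ closure Ω))
    (hFell : Ellip4 F)
    (m : ℝ) (hH4 : H4p Ω F m)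
    (g : Euc N → ℝ) (hg : ContinuousOn g (frontier Ω))
    (u : Euc N → ℝ)
    (hu_usc : UpperSemicontinuousOn u (closure Ω))
    (hu_bdd : ∃ C : ℝ, ∀ x ∈ closure Ω, |u x| ≤ C)
    (hu_sub : DirSub Ω F g u)
    (hu_lim : ∀ x ∈ frontier Ω, u x = Filter.limsup u (𝓝[Ω] x)) :
    ∀ x ∈ frontier Ω, u x ≤ g x := by
  intro x hx
  by_contra! hlt
  obtain ⟨C, hC⟩ := hu_bdd
  obtain ⟨n, hn, hnθ⟩ := exists_inner_normal hΩ hx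
  have hxc : x ∈ closure Ω := frontier_subset_closure hx
  have hC0 : 0 ≤ C := (abs_nonneg _).trans (hC x hxc)
  obtain ⟨hm, hH⟩ := hH4
  obtain ⟨K₁, K₂, -, G, hK₁, hK₂, -, -, -, hG, hFG⟩ := hH (C + 1) (by linarith)
  have hgx := hg x hx
  obtain ⟨η, hη, hη1, hgη⟩ : ∃ η : ℝ, 0 < η ∧ η ≤ 1 ∧ g x < u x - η :=
    ⟨min 1 ((u x - g x) / 2), lt_min one_pos (by linarith), min_le_left _ _,
      by linarith [min_le_right 1 ((u x - g x) / 2)]⟩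
  obtain ⟨ρ, hρ, hgρ⟩ : ∃ ρ : ℝ, 0 < ρ ∧ ∀ y ∈ frontier Ω, ‖y - x‖ < ρ → g y < u x - η := by
    obtain ⟨ρ, hρ, h⟩ := Metric.mem_nhdsWithin_iff.1 (hgx.eventually_lt_const hgη)
    exact ⟨ρ, hρ, fun y hy hyr => h ⟨by rwa [mem_ball, dist_eq_norm], hy⟩⟩
  set c : ℝ := 4 * C + 1 with hc
  have hc1 : 1 ≤ c := by linarith
  set θ : ℝ := η / (4 * c) with hθ
  have hθ0 : 0 < θ := by positivity
  have hθc : θ * c = η / 4 := by rw [hθ]; field_simp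
  obtain ⟨r, hr, hnr⟩ := hnθ θ hθ0
  set B : ℝ := 4 * (K₂ + 2 * (θ ^ 2 / η) * |G 1| + 1) / K₁ with hB
  have htend : Tendsto (fun t : ℝ => (t / 2) ^ (m - 2)) atTop atTop :=
    (tendsto_rpow_atTop (by linarith)).comp (tendsto_id.atTop_div_const (by norm_num))
  obtain ⟨lam, hl1, hlr, hlρ, hlB⟩ : ∃ lam : ℝ, 1 ≤ lam ∧ 2 * ‖n‖ / (θ ^ 2 * r) ≤ lam ∧
      c / (θ * ρ) < lam ∧ B ≤ (lam / 2) ^ (m - 2) :=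
    ((eventually_ge_atTop 1).and ((eventually_ge_atTop _).and
      ((eventually_gt_atTop _).and (htend.eventually_ge_atTop B)))).exists
  have hl0 : 0 < lam := by linarith
  set a : ℝ := (lam * θ) ^ 2 / η with ha
  have ha0 : 0 < a := by positivity
  have haη : a * η = (lam * θ) ^ 2 := by rw [ha]; field_simp
  set φ := quadTest (lam • n) x a with hφ
  have hφlow : ∀ y ∈ closure Ω, a / 2 * ‖y - x‖ ^ 2 - η / 2 ≤ φ y := by
    intro y hy
    rw [hφ, quadTest, inner_smul_left]
    simp only [conj_trivial]
    suffices -(a / 2 * ‖y - x‖ ^ 2 + η / 2) ≤ lam * inner ℝ n (y - x) by linarith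
    rcases lt_or_ge ‖y - x‖ r with h | h
    · have h1 := mul_le_mul_of_nonneg_left (hnr y hy h) hl0.le
      have h2 : lam * θ * ‖y - x‖ ≤ a / 2 * ‖y - x‖ ^ 2 + η / 2 := by
        have h3 : a * ‖y - x‖ ^ 2 + η - 2 * (lam * θ * ‖y - x‖)
            = (lam * θ * ‖y - x‖ - η) ^ 2 / η := by
          rw [ha]
          field_simp
          ring
        have h4 : 0 ≤ (lam * θ * ‖y - x‖ - η) ^ 2 / η := by positivity
        linarith
      linarith
    · have h1 : -(‖n‖ * ‖y - x‖) ≤ inner ℝ n (y - x) :=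
        (abs_le.1 (abs_real_inner_le_norm n (y - x))).1
      have h2 := mul_le_mul_of_nonneg_left h1 hl0.le
      rw [div_le_iff₀ (by positivity)] at hlr
      have h3 : lam * ‖n‖ ≤ a / 2 * ‖y - x‖ := by
        have : 2 * ‖n‖ ≤ lam * (θ ^ 2 * ‖y - x‖) := hlr.trans (by gcongr)
        have := mul_le_mul_of_nonneg_left this hl0.le
        have h5 : (lam * θ) ^ 2 ≤ a := by nlinarith
        have h6 := mul_le_mul_of_nonneg_right h5 (norm_nonneg (y - x))
        linarith
      have h4 := mul_le_mul_of_nonneg_right h3 (norm_nonneg (y - x))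
      linarith
  have hcomp : IsCompact (closure Ω) := hΩ.2.1.isCompact_closure
  have hφc : Continuous φ := (contDiff_quadTest _ _ _).continuous
  have husc : UpperSemicontinuousOn (fun y => u y - φ y) (closure Ω) := by
    simp only [sub_eq_add_neg]
    exact hu_usc.add (hφc.neg.upperSemicontinuous.upperSemicontinuousOn _)
  obtain ⟨z, hz, hzmax⟩ := husc.exists_isMaxOn ⟨x, hxc⟩ hcomp
  have hφx : φ x = 0 := by simp [hφ, quadTest]
  have hmaxx : u x ≤ u z - φ z := by simpa [hφx] using hzmax hxc
  have hux := abs_le.1 (hC x hxc)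
  have huz := abs_le.1 (hC z hz)
  have hzx : lam * θ * ‖z - x‖ ≤ c := by
    have h1 : (lam * θ * ‖z - x‖) ^ 2 ≤ c := by
      have h2 : a * ‖z - x‖ ^ 2 ≤ c := by linarith [hφlow z hz]
      have h3 := mul_le_mul_of_nonneg_right h2 hη.le
      rw [mul_pow, ← haη]
      nlinarith
    exact abs_le_of_sq_le_sq' (h1.trans (by nlinarith)) (by linarith) |>.2
  have hzρ : ‖z - x‖ < ρ := by
    rw [div_lt_iff₀ (by positivity)] at hlρ
    have : lam * θ * ‖z - x‖ < lam * θ * ρ := by linarith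
    exact lt_of_mul_lt_mul_left this (by positivity)
  have hnotF : ¬ F (hessM φ z) (gradient φ z) (u z) z ≤ 0 := by
    intro hF
    have h1 := hFG _ _ _ z hz ((hC z hz).trans (by linarith)) hF
    rw [hφ, hessM_quadTest, gradient_quadTest, hG _ (by positivity)] at h1
    have h2 : lam / 2 ≤ ‖lam • n + (2 * a) • (z - x)‖ := by
      have h3 := norm_sub_le_norm_add (lam • n) ((2 * a) • (z - x))
      rw [norm_smul, norm_smul, Real.norm_of_nonneg hl0.le,
        Real.norm_of_nonneg (by positivity)] at h3
      have h4 : 2 * a * ‖z - x‖ ≤ lam / 2 := by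
        have := mul_le_mul_of_nonneg_left hzx (show 0 ≤ 2 * (lam * θ) / η by positivity)
        have h5 : 2 * (lam * θ) / η * c = lam / 2 := by
          field_simp
          linear_combination 4 * hθc
        have h6 : 2 * a * ‖z - x‖ = 2 * (lam * θ) / η * (lam * θ * ‖z - x‖) := by
          rw [ha]
          ring
        linarith
      nlinarith
    have h5 : (lam / 2) ^ m ≤ ‖lam • n + (2 * a) • (z - x)‖ ^ m :=
      Real.rpow_le_rpow (by positivity) h2 (by linarith)
    have h6 : (lam / 2) ^ m = (lam / 2) ^ (m - 2) * (lam / 2) ^ 2 := by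
      rw [← Real.rpow_natCast, ← Real.rpow_add (by positivity)]
      norm_num
    have h7 : K₁ * (B * (lam / 2) ^ 2) ≤ K₁ * ‖lam • n + (2 * a) • (z - x)‖ ^ m := by
      refine mul_le_mul_of_nonneg_left (le_trans ?_ h5) hK₁.le
      rw [h6]
      gcongr
    have h8 : K₁ * (B * (lam / 2) ^ 2) = (K₂ + 2 * (θ ^ 2 / η) * |G 1| + 1) * lam ^ 2 := by
      rw [hB]
      field_simp
      ring
    have h9 : -(2 * a * |G 1|) ≤ 2 * a * G 1 := by
      have := mul_le_mul_of_nonneg_left (neg_abs_le (G 1)) (show 0 ≤ 2 * a by positivity)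
      linarith
    have h10 : 2 * a * |G 1| = 2 * (θ ^ 2 / η) * |G 1| * lam ^ 2 := by rw [ha]; ring
    have h11 : (1 : ℝ) ≤ lam ^ 2 := one_le_pow₀ hl1
    have h12 := mul_le_mul_of_nonneg_left h11 hK₂.le
    linarith
  obtain ⟨hin, hbd⟩ := hu_sub φ (contDiff_quadTest _ _ _) z hz hzmax.localize
  by_cases hzΩ : z ∈ Ω
  · exact hnotF (hin hzΩ)
  · have hzf : z ∈ frontier Ω := by rw [hΩ.1.frontier_eq]; exact ⟨hz, hzΩ⟩
    rcases min_le_iff.1 (hbd hzf) with h | h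
    · exact hnotF h
    · have h1 := hgρ z hzf hzρ
      have h2 := hφlow z hz
      have h3 : 0 ≤ a / 2 * ‖z - x‖ ^ 2 := by positivity
      linarith
end
end

section
/- Let h belong to the class 𝒫 with h(t) > 0 for t ≥ 1. Then: (a) h(t)/t² → +∞ as t → +∞; (b) ∫₁^{+∞} t²h'(t)/[h(t)]² dt < +∞; (c) h(t) ≥ t² h(1) for all t ≥ 1, and h(Ct) ≥ C² h(t) for all C ≥ 1 and t ≥ 1. -/
open Metric Set Filter Topology

noncomputable section

namespace Visc

/-- Assumption (H6) for a family of nonlinearities, uniformly with respect to the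
index (the same `β`, moduli `m_{R,K}` and constants `C(μ)` work for every member
of the family). -/
def H6Fam {N : ℕ} {ι : Sort*} (Ω : Set (Euc N))
    (Fam : ι → Mat N → Euc N → ℝ → Euc N → ℝ) (α : ℝ) : Prop :=
  ∃ β : ℝ, 0 < β ∧ β < α ∧ ∀ μ : ℝ, 0 < μ → μ < 1 → ∀ R K : ℝ, 0 < R → 0 < K →
    ∃ (mRK : ℝ → ℝ) (Cμ : ℝ), 0 ≤ Cμ ∧ Tendsto mRK (𝓝[>] 0) (𝓝 0) ∧
      ∀ i : ι, ∀ ε : ℝ, 0 < ε → ∀ x ∈ closure Ω, ∀ y ∈ closure Ω, ∀ r : ℝ, |r| ≤ R →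
        ∀ (p q : Euc N) (X Y : Mat N), MatIneq K ε α β X Y →
          ‖p - q‖ ≤ K * ε * (1 + ‖p‖ + ‖q‖) → ‖p‖ + ‖q‖ ≤ K * ε ^ (α - 1 - β) →
          dist x y ≤ K * ε →
          Fam i Y q r y - μ * Fam i (μ⁻¹ • X) (μ⁻¹ • p) (μ⁻¹ * r) x ≤
            mRK ((1 - μ) + Cμ * ε)

end Visc

namespace Visc.ClassP

variable {h : ℝ → ℝ}

theorem sq_mul_le (hP : ClassP h) {C t : ℝ} (hC : 1 ≤ C) (ht : 1 ≤ t) :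
    C ^ 2 * h t ≤ h (C * t) := by
  have hCt : t ≤ C * t := le_mul_of_one_le_left (by linarith) hC
  have hmono : h t / t ^ 2 ≤ h (C * t) / (C * t) ^ 2 := hP.mono ht (ht.trans hCt) hCt
  have hC0 : 0 < C := by linarith
  have ht0 : 0 < t := by linarith
  rw [le_div_iff₀ (by positivity)] at hmono
  calc C ^ 2 * h t = h t / t ^ 2 * (C * t) ^ 2 := by field_simp
    _ ≤ h (C * t) := hmono

theorem tendsto_div_sq_atTop (hP : ClassP h) (hpos : ∀ t : ℝ, 1 ≤ t → 0 < h t) :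
    Tendsto (fun t : ℝ => h t / t ^ 2) atTop atTop := by
  rw [Filter.tendsto_atTop]
  intro b
  by_contra hb
  have hlt : ∀ t : ℝ, 1 ≤ t → h t / t ^ 2 < b := by
    intro t ht
    by_contra! hbt
    refine hb ?_
    filter_upwards [eventually_ge_atTop t] with s hs
    exact hbt.trans (hP.mono ht (ht.trans hs) hs)
  refine not_integrableOn_Ioi_inv (a := (1 : ℝ)) ?_
  refine ((hP.integrable.mono_set Ioi_subset_Ici_self).const_mul b).mono'
    measurable_inv.aestronglyMeasurable ?_
  refine (MeasureTheory.ae_restrict_mem measurableSet_Ioi).mono fun t (ht : 1 < t) => ?_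
  have ht0 : 0 < t := by linarith
  have hht := hpos t ht.le
  have hle := hlt t ht.le
  rw [div_lt_iff₀ (by positivity)] at hle
  rw [Real.norm_of_nonneg (by positivity), ← mul_div_assoc, le_div_iff₀ hht, inv_mul_le_iff₀ ht0]
  linarith

theorem hasDerivAt_neg_sq_div (hP : ClassP h) (hpos : ∀ t : ℝ, 1 ≤ t → 0 < h t)
    {t : ℝ} (ht : 1 ≤ t) :
    HasDerivAt (fun s => -(s ^ 2 / h s)) (t ^ 2 * deriv h t / h t ^ 2 - 2 * (t / h t)) t := by
  have hd : HasDerivAt h (deriv h t) t :=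
    ((hP.contDiff.differentiableOn one_ne_zero).differentiableAt
      (Ici_mem_nhds (by linarith))).hasDerivAt
  have hne := (hpos t ht).ne'
  refine ((hasDerivAt_pow 2 t).fun_div hd hne).fun_neg.congr_deriv ?_
  field_simp
  push_cast
  ring

theorem monotoneOn_neg_sq_div (hP : ClassP h) (hpos : ∀ t : ℝ, 1 ≤ t → 0 < h t) :
    MonotoneOn (fun s => -(s ^ 2 / h s)) (Ici 1) := by
  intro s (hs : 1 ≤ s) t (ht : 1 ≤ t) hst
  have hle : h s / s ^ 2 ≤ h t / t ^ 2 := hP.mono hs ht hst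
  have hs0 : 0 < h s / s ^ 2 := div_pos (hpos s hs) (by positivity)
  simpa only [one_div_div, neg_le_neg_iff] using one_div_le_one_div_of_le hs0 hle

theorem tendsto_neg_sq_div (hP : ClassP h) (hpos : ∀ t : ℝ, 1 ≤ t → 0 < h t) :
    Tendsto (fun s => -(s ^ 2 / h s)) atTop (𝓝 0) := by
  simpa using (tendsto_inv_atTop_zero.comp (hP.tendsto_div_sq_atTop hpos)).neg

theorem integrableOn_sq_mul_deriv_div (hP : ClassP h) (hpos : ∀ t : ℝ, 1 ≤ t → 0 < h t) :
    MeasureTheory.IntegrableOn (fun t : ℝ => t ^ 2 * deriv h t / h t ^ 2) (Ici 1) := by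
  rw [integrableOn_Ici_iff_integrableOn_Ioi]
  have h_deriv := MeasureTheory.integrableOn_Ioi_deriv_of_nonneg'
    (fun t (ht : 1 ≤ t) => hP.hasDerivAt_neg_sq_div hpos ht) (fun t (ht : 1 < t) => ?_)
    (hP.tendsto_neg_sq_div hpos)
  · refine (h_deriv.add ((hP.integrable.mono_set Ioi_subset_Ici_self).const_mul 2)).congr ?_
    exact Eventually.of_forall fun t => sub_add_cancel _ _
  · rw [← (hP.hasDerivAt_neg_sq_div hpos ht.le).deriv,
      ← derivWithin_of_mem_nhds (Ici_mem_nhds ht)]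
    exact (hP.monotoneOn_neg_sq_div hpos).derivWithin_nonneg

end Visc.ClassP

open Visc in
/-- properties of the class `𝒫`.
If `h ∈ 𝒫` and `h > 0` on `[1,∞)`, then (a) `h(t)/t² → +∞` as `t → +∞`;
(b) `∫₁^∞ t² h'(t)/h(t)² dt < +∞`; (c) `h(t) ≥ t² h(1)` for `t ≥ 1` and
`h(Ct) ≥ C² h(t)` for `C ≥ 1`, `t ≥ 1`. -/
theorem classP_properties (h : ℝ → ℝ) (hP : ClassP h)
    (hpos : ∀ t : ℝ, 1 ≤ t → 0 < h t) :
    Tendsto (fun t : ℝ => h t / t ^ 2) atTop atTop ∧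
    MeasureTheory.IntegrableOn
      (fun t : ℝ => t ^ 2 * deriv h t / (h t) ^ 2) (Ici (1 : ℝ)) ∧
    (∀ t : ℝ, 1 ≤ t → t ^ 2 * h 1 ≤ h t) ∧
    (∀ C t : ℝ, 1 ≤ C → 1 ≤ t → C ^ 2 * h t ≤ h (C * t)) :=
  ⟨hP.tendsto_div_sq_atTop hpos, hP.integrableOn_sq_mul_deriv_div hpos,
    fun t ht => by simpa using hP.sq_mul_le ht le_rfl, fun _ _ hC ht => hP.sq_mul_le hC ht⟩
end
end

section
/- Let N ≥ 3, 1 ≤ p ≤ 2, 0 < α ≤ 1 and C > 0 with Cα ≤ 1. Then the function v(x) = C|x|^α is smooth on ℝ^N ∖ {0} and satisfies the pointwise inequality −Δv(x) + |Dv(x)|^p ≤ 0 for every x ∈ B₁(0) ∖ {0}, i.e. v is a classical subsolution of −Δu + |Du|^p = 0 in the punctured unit ball. (Consequently, in the subquadratic case 1 ≤ p ≤ 2 there is no uniform local modulus of continuity for subsolutions: the particular subsolutions α^{-1}|x|^α, α → 0, have blowing-up Hölder constants.) -/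
open Metric Set Filter Topology

noncomputable section

/-- Away from the origin, `‖·‖ ^ p` has derivative `p ‖x‖ ^ (p - 2) ⟨x, ·⟩` for every real `p`. -/
theorem hasFDerivAt_norm_rpow_of_ne_zero {E : Type*} [NormedAddCommGroup E]
    [InnerProductSpace ℝ E] {x : E} (hx : x ≠ 0) (p : ℝ) :
    HasFDerivAt (fun y : E => ‖y‖ ^ p) ((p * ‖x‖ ^ (p - 2)) • innerSL ℝ x) x := by
  have hpos : 0 < ‖x‖ := norm_pos_iff.2 hx
  have h := ((hasStrictFDerivAt_norm_sq x).hasFDerivAt).rpow_const (p := p / 2)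
    (Or.inl (by positivity))
  have hpow : ∀ (y : E) (s : ℝ), (‖y‖ ^ 2) ^ s = ‖y‖ ^ (2 * s) := fun y s => by
    rw [← Real.rpow_natCast, ← Real.rpow_mul (norm_nonneg y), Nat.cast_ofNat]
  simp only [hpow] at h
  convert h using 1
  · ext y
    ring_nf
  · rw [show 2 * (p / 2 - 1) = p - 2 by ring, ← Nat.cast_smul_eq_nsmul ℝ, smul_smul]
    congr 1
    push_cast
    ring

/-- The Fréchet derivative of `C ‖·‖ ^ α` away from the origin. -/
theorem fderiv_const_mul_norm_rpow {E : Type*} [NormedAddCommGroup E]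
    [InnerProductSpace ℝ E] {x : E} (hx : x ≠ 0) (C α : ℝ) :
    fderiv ℝ (fun y : E => C * ‖y‖ ^ α) x = (C * α * ‖x‖ ^ (α - 2)) • innerSL ℝ x := by
  rw [((hasFDerivAt_norm_rpow_of_ne_zero hx α).const_mul C).fderiv, smul_smul, mul_assoc]

/-- The second derivative of `C ‖·‖ ^ α` away from the origin. -/
theorem fderiv_fderiv_const_mul_norm_rpow {E : Type*} [NormedAddCommGroup E]
    [InnerProductSpace ℝ E] {x : E} (hx : x ≠ 0) (C α : ℝ) (v w : E) :
    fderiv ℝ (fderiv ℝ (fun y : E => C * ‖y‖ ^ α)) x v w =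
      C * α * (‖x‖ ^ (α - 2) * inner ℝ v w +
        (α - 2) * ‖x‖ ^ (α - 2 - 2) * (inner ℝ x v * inner ℝ x w)) := by
  have heq : fderiv ℝ (fun y : E => C * ‖y‖ ^ α) =ᶠ[𝓝 x]
      fun y => (C * α * ‖y‖ ^ (α - 2)) • innerSL ℝ y := by
    filter_upwards [isOpen_ne.mem_nhds hx] with y hy
    exact fderiv_const_mul_norm_rpow hy C α
  have h := ((hasFDerivAt_norm_rpow_of_ne_zero hx (α - 2)).const_mul (C * α)).fun_smul
    (innerSL ℝ (E := E)).hasFDerivAt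
  rw [heq.fderiv_eq, h.fderiv]
  change C * α * ‖x‖ ^ (α - 2) * inner ℝ v w +
    C * α * ((α - 2) * ‖x‖ ^ (α - 2 - 2) * inner ℝ x v) * inner ℝ x w = _
  ring

/-- The Laplacian of `C ‖·‖ ^ α` on `ℝ^N` away from the origin, as the trace of the Hessian. -/
theorem trace_hessM_const_mul_norm_rpow {N : ℕ} {x : Euc N} (hx : x ≠ 0) (C α : ℝ) :
    Matrix.trace (Visc.hessM (fun y : Euc N => C * ‖y‖ ^ α) x) =
      C * α * (N - 2 + α) * ‖x‖ ^ (α - 2) := by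
  have hpos : 0 < ‖x‖ := norm_pos_iff.2 hx
  have hdiag : ∀ i : Fin N, Visc.hessM (fun y : Euc N => C * ‖y‖ ^ α) x i i =
      C * α * (‖x‖ ^ (α - 2) + (α - 2) * ‖x‖ ^ (α - 2 - 2) * x i ^ 2) := fun i => by
    simp only [Visc.hessM, Matrix.of_apply, iteratedFDeriv_two_apply, Matrix.cons_val_zero,
      Matrix.cons_val_one, fderiv_fderiv_const_mul_norm_rpow hx]
    simp [EuclideanSpace.inner_single_right, sq]
  have hpow : ‖x‖ ^ (α - 2 - 2) * ‖x‖ ^ 2 = ‖x‖ ^ (α - 2) := by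
    rw [← Real.rpow_natCast, ← Real.rpow_add hpos]
    norm_num
  simp only [Matrix.trace, Matrix.diag_apply, hdiag]
  rw [← Finset.mul_sum, Finset.sum_add_distrib, ← Finset.mul_sum,
    ← EuclideanSpace.real_norm_sq_eq, mul_assoc (α - 2), hpow]
  simp
  ring

/-- The norm of the gradient of `C ‖·‖ ^ α` away from the origin. -/
theorem norm_gradient_const_mul_norm_rpow {E : Type*} [NormedAddCommGroup E]
    [InnerProductSpace ℝ E] [CompleteSpace E] {x : E} (hx : x ≠ 0) {C α : ℝ} (hCα : 0 ≤ C * α) :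
    ‖gradient (fun y : E => C * ‖y‖ ^ α) x‖ = C * α * ‖x‖ ^ (α - 1) := by
  have hpos : 0 < ‖x‖ := norm_pos_iff.2 hx
  rw [gradient, LinearIsometryEquiv.norm_map, fderiv_const_mul_norm_rpow hx, norm_smul,
    innerSL_apply_norm, Real.norm_of_nonneg (by positivity), mul_assoc,
    ← Real.rpow_add_one hpos.ne']
  ring_nf

open Visc in
/-- the subquadratic counterexample of Section 2.1.
For `N ≥ 3`, `1 ≤ p ≤ 2`, `0 < α ≤ 1` and `C > 0` with `Cα ≤ 1`, the function
`v(x) = C|x|^α` is smooth away from the origin and is a classical subsolution of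
`-Δv + |Dv|^p ≤ 0` in the punctured unit ball (the Laplacian being the trace of
the Hessian matrix). -/
theorem subquadratic_counterexample
    {N : ℕ} (hN : 3 ≤ N) (p C α : ℝ)
    (hp1 : 1 ≤ p) (hp2 : p ≤ 2) (hα0 : 0 < α) (hα1 : α ≤ 1)
    (hC : 0 < C) (hCα : C * α ≤ 1) :
    ContDiffOn ℝ (⊤ : ℕ∞) (fun x : Euc N => C * ‖x‖ ^ α) {x : Euc N | x ≠ 0} ∧
    ∀ x ∈ ball (0 : Euc N) 1 \ {(0 : Euc N)},
      -Matrix.trace (hessM (fun y : Euc N => C * ‖y‖ ^ α) x) +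
        ‖gradient (fun y : Euc N => C * ‖y‖ ^ α) x‖ ^ p ≤ 0 := by
  refine ⟨fun x hx => ?_, ?_⟩
  · exact (contDiffAt_const.mul
      ((contDiffAt_norm ℝ hx).rpow_const_of_ne (norm_ne_zero_iff.2 hx))).contDiffWithinAt
  · rintro x ⟨hx1, hx0⟩
    have hx : x ≠ 0 := hx0
    have hpos : 0 < ‖x‖ := norm_pos_iff.2 hx
    have hle : ‖x‖ ≤ 1 := (mem_ball_zero_iff.1 hx1).le
    have hA : 0 < C * α := mul_pos hC hα0
    have hN' : (3 : ℝ) ≤ N := by exact_mod_cast hN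
    rw [trace_hessM_const_mul_norm_rpow hx, norm_gradient_const_mul_norm_rpow hx hA.le,
      Real.mul_rpow hA.le (by positivity), ← Real.rpow_mul hpos.le]
    have h1 : (C * α) ^ p ≤ C * α := by
      simpa using Real.rpow_le_rpow_of_exponent_ge hA hCα hp1
    have h2 : ‖x‖ ^ ((α - 1) * p) ≤ ‖x‖ ^ (α - 2) :=
      Real.rpow_le_rpow_of_exponent_ge hpos hle (by nlinarith)
    have h3 : (C * α) ^ p * ‖x‖ ^ ((α - 1) * p) ≤ C * α * ‖x‖ ^ (α - 2) := by gcongr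
    have h4 : C * α * 1 * ‖x‖ ^ (α - 2) ≤ C * α * (N - 2 + α) * ‖x‖ ^ (α - 2) := by
      gcongr
      linarith
    linarith
end
end

section
/- Let h belong to the class 𝒫 with h(t) > 0 for t ≥ 1, and set T = ∫₁^{+∞} ds/h(s) (a finite positive number). Then there exists a function χ₂ : [0,T] → ℝ, continuous on [0,T] and C² on (0,T], such that χ₂(0) = 0, χ₂ is strictly increasing, χ₂'(t) → +∞ as t → 0⁺, and χ₂''(t) = −h(χ₂'(t)) for all t ∈ (0,T]. Explicitly, χ₂' is the inverse of the strictly decreasing bijection F : [1,∞) → (0,T], F(τ) = ∫_τ^{+∞} ds/h(s), and χ₂(t) ≤ ∫₁^{+∞} s/h(s) ds + χ₂(T) − χ₂(t₀) is finite as t → 0⁺ thanks to the convergence of ∫₁^{+∞} s/h(s) ds. -/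
open Metric Set Filter Topology

noncomputable section

section TailIntegrals

open MeasureTheory

theorem Continuous.integrableOn_Ioi_of_integrableOn_Ioi {f : ℝ → ℝ} (hf : Continuous f) {a : ℝ}
    (ha : IntegrableOn f (Ioi a)) (b : ℝ) : IntegrableOn f (Ioi b) :=
  ((hf.integrableOn_Icc (a := b) (b := a)).union ha).mono_set fun x hx =>
    (le_or_gt x a).imp (fun h => ⟨(mem_Ioi.1 hx).le, h⟩) fun h => h

theorem Continuous.hasDerivAt_integral_Ioi {f : ℝ → ℝ} (hf : Continuous f) {a : ℝ}
    (ha : IntegrableOn f (Ioi a)) (x : ℝ) :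
    HasDerivAt (fun y => ∫ s in Ioi y, f s) (-f x) x := by
  have hint := hf.integrableOn_Ioi_of_integrableOn_Ioi ha
  have heq : (fun y => ∫ s in Ioi y, f s) = fun y => (∫ s in Ioi a, f s) - ∫ s in a..y, f s := by
    funext y
    rw [← intervalIntegral.integral_Ioi_sub_Ioi' ha (hint y), sub_sub_cancel]
  rw [heq]
  exact (hf.integral_hasStrictDerivAt a x).hasDerivAt.const_sub _

end TailIntegrals

/-- A continuous strictly decreasing function from `ℝ` onto `(0,∞)` has a right inverse which is
continuous on `(0,∞)` and tends to `+∞` at `0⁺`. -/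
theorem StrictAnti.exists_continuousAt_rightInverse {F : ℝ → ℝ} (hF : StrictAnti F)
    (hc : Continuous F) (hpos : ∀ x, 0 < F x) (htop : Tendsto F atTop (𝓝 0))
    (hunb : ∀ t, ∃ x, t ≤ F x) :
    ∃ G : ℝ → ℝ, (∀ t, 0 < t → F (G t) = t) ∧ (∀ t, 0 < t → ContinuousAt G t) ∧
      Tendsto G (𝓝[>] 0) atTop := by
  have hsurj : ∀ t, 0 < t → ∃ x, F x = t := fun t ht =>
    mem_range_of_exists_le_of_exists_ge hc
      ((htop.eventually (gt_mem_nhds ht)).exists.imp fun _ h => h.le) (hunb t)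
  choose! G hG using hsurj
  refine ⟨G, hG, fun t ht => tendsto_order.2 ⟨fun l hl => ?_, fun u hu => ?_⟩,
    tendsto_atTop.2 fun M => ?_⟩
  · have : t < F l := (hG t ht).symm.trans_lt (hF hl)
    filter_upwards [gt_mem_nhds this, lt_mem_nhds ht] with y hy hy0
    exact hF.lt_iff_gt.1 ((hG y hy0).trans_lt hy)
  · have : F u < t := (hF hu).trans_eq (hG t ht)
    filter_upwards [lt_mem_nhds this, lt_mem_nhds ht] with y hy hy0
    exact hF.lt_iff_gt.1 (hy.trans_eq (hG y hy0).symm)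
  · filter_upwards [Ioo_mem_nhdsGT (hpos M)] with y hy
    exact (hF.lt_iff_gt.1 ((hG y hy.1).trans_lt hy.2)).le

open MeasureTheory in
/-- Solution of `χ'' = -g(χ')` on `(0,∞)` with `χ(0) = 0` and `χ'(0⁺) = +∞`, obtained by inverting
`τ ↦ ∫_τ^∞ ds/g(s)`. -/
theorem exists_hasDerivAt_eq_neg_comp {g : ℝ → ℝ} (hg : Continuous g) (hpos : ∀ s, 0 < g s)
    {a : ℝ} (hint : IntegrableOn (fun s => (g s)⁻¹) (Ioi a))
    (hint' : IntegrableOn (fun s => s / g s) (Ioi a))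
    (hunb : ∀ t, ∃ x, t ≤ ∫ s in Ioi x, (g s)⁻¹) :
    ∃ χ G : ℝ → ℝ, χ 0 = 0 ∧ ContinuousWithinAt χ (Ici 0) 0 ∧
      (∀ t, 0 < t → HasDerivAt χ (G t) t ∧ HasDerivAt G (-g (G t)) t ∧
        ∫ s in Ioi (G t), (g s)⁻¹ = t) ∧
      Tendsto G (𝓝[>] 0) atTop := by
  have hginv : Continuous fun s => (g s)⁻¹ := hg.inv₀ fun s => (hpos s).ne'
  have hgdiv : Continuous fun s => s / g s := continuous_id.div hg fun s => (hpos s).ne'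
  have hFd := hginv.hasDerivAt_integral_Ioi hint
  have hHd := hgdiv.hasDerivAt_integral_Ioi hint'
  have hFanti : StrictAnti fun x => ∫ s in Ioi x, (g s)⁻¹ := strictAnti_of_deriv_neg fun x => by
    rw [(hFd x).deriv]
    exact neg_neg_of_pos (inv_pos.2 (hpos x))
  have hFpos : ∀ x, 0 < ∫ s in Ioi x, (g s)⁻¹ := fun x =>
    (setIntegral_nonneg measurableSet_Ioi fun s _ => (inv_pos.2 (hpos s)).le).trans_lt
      (hFanti (lt_add_one x))
  obtain ⟨G, hFG, hGc, hGtop⟩ := hFanti.exists_continuousAt_rightInverse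
    (continuous_iff_continuousAt.2 fun x => (hFd x).continuousAt) hFpos
    (tendsto_integral_Ioi_zero tendsto_id) hunb
  have hGd : ∀ t, 0 < t → HasDerivAt G (-g (G t)) t := fun t ht => by
    have := (hFd (G t)).of_local_left_inverse (hGc t ht)
      (neg_ne_zero.2 (inv_ne_zero (hpos _).ne'))
      ((lt_mem_nhds ht).mono fun y hy => hFG y hy)
    rwa [inv_neg, inv_inv] at this
  refine ⟨fun t => if 0 < t then ∫ s in Ioi (G t), s / g s else 0, G, if_neg (lt_irrefl _), ?_,
    fun t ht => ⟨?_, hGd t ht, hFG t ht⟩, hGtop⟩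
  · rw [← continuousWithinAt_Ioi_iff_Ici, ContinuousWithinAt, if_neg (lt_irrefl _)]
    refine Tendsto.congr' ?_ (tendsto_integral_Ioi_zero (μ := volume) (f := fun s => s / g s) hGtop)
    filter_upwards [self_mem_nhdsWithin] with t ht
    exact (if_pos ht).symm
  · have h := (hHd (G t)).comp t (hGd t ht)
    have hval : -(G t / g (G t)) * -g (G t) = G t := by
      have := (hpos (G t)).ne'
      field_simp
    rw [hval] at h
    refine h.congr_of_eventuallyEq ((lt_mem_nhds ht).mono fun y hy => if_pos hy)

open MeasureTheory in
theorem exists_le_integral_Ioi_of_eq_const {f : ℝ → ℝ} {a c : ℝ} (hc : 0 < c)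
    (hint : ∀ b, IntegrableOn f (Ioi b)) (hnonneg : 0 ≤ ∫ s in Ioi a, f s)
    (hconst : ∀ s ≤ a, f s = c) (t : ℝ) : ∃ x, t ≤ ∫ s in Ioi x, f s := by
  refine ⟨a - |t| / c, ?_⟩
  have hle : a - |t| / c ≤ a := sub_le_self _ (by positivity)
  have hsub := intervalIntegral.integral_Ioi_sub_Ioi (hint (a - |t| / c)) hle
  have hval : ∫ s in (a - |t| / c)..a, f s = |t| := by
    rw [intervalIntegral.integral_congr (g := fun _ => c) fun s hs =>
      hconst s (uIcc_of_le hle ▸ hs).2, intervalIntegral.integral_const, smul_eq_mul]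
    field_simp
    ring
  linarith [le_abs_self t]

open Visc in
open MeasureTheory in
/-- Appendix: the function `χ₂`.
For `h ∈ 𝒫` with `h > 0` on `[1,∞)`, setting `T = ∫₁^∞ ds/h(s)` (a finite
positive number), there is a function `χ₂`, continuous on `[0,T]` and `C²` on
`(0,T]`, with `χ₂(0) = 0`, strictly increasing, `χ₂'(t) → +∞` as `t → 0⁺`,
solving `χ₂'' = -h(χ₂')` on `(0,T]`; its derivative is the inverse of the
strictly decreasing bijection `F(τ) = ∫_τ^∞ ds/h(s)` from `[1,∞)` onto `(0,T]`,
i.e. `F(χ₂'(t)) = t` (and `χ₂' ≥ 1`) on `(0,T]`. -/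
theorem chi_two_existence (h : ℝ → ℝ) (hP : ClassP h)
    (hpos : ∀ t : ℝ, 1 ≤ t → 0 < h t) :
    0 < (∫ s in Ici (1 : ℝ), (h s)⁻¹) ∧
    ∃ χ : ℝ → ℝ,
      ContinuousOn χ (Icc 0 (∫ s in Ici (1 : ℝ), (h s)⁻¹)) ∧
      ContDiffOn ℝ 2 χ (Ioc 0 (∫ s in Ici (1 : ℝ), (h s)⁻¹)) ∧
      χ 0 = 0 ∧
      StrictMonoOn χ (Icc 0 (∫ s in Ici (1 : ℝ), (h s)⁻¹)) ∧
      Tendsto (deriv χ) (𝓝[>] (0 : ℝ)) atTop ∧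
      (∀ t ∈ Ioc (0 : ℝ) (∫ s in Ici (1 : ℝ), (h s)⁻¹),
        deriv (deriv χ) t = -h (deriv χ t)) ∧
      (∀ t ∈ Ioc (0 : ℝ) (∫ s in Ici (1 : ℝ), (h s)⁻¹),
        1 ≤ deriv χ t ∧ (∫ s in Ici (deriv χ t), (h s)⁻¹) = t) := by
  let g : ℝ → ℝ := fun s => h (max s 1)
  have hmax : ∀ s : ℝ, (1 : ℝ) ≤ max s 1 := fun s => le_max_right s 1
  have hgh : ∀ s : ℝ, 1 ≤ s → g s = h s := fun s hs => by simp only [g, max_eq_left hs]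
  have hg : Continuous g := hP.contDiff.continuousOn.comp_continuous
    (continuous_id.max continuous_const) fun s => zero_le_one.trans (hmax s)
  have hgpos : ∀ s, 0 < g s := fun s => hpos _ (hmax s)
  have hginv : Continuous fun s => (g s)⁻¹ := hg.inv₀ fun s => (hgpos s).ne'
  have hint' : IntegrableOn (fun s => s / g s) (Ioi 1) :=
    (hP.integrable.mono_set Ioi_subset_Ici_self).congr_fun
      (fun s hs => by simp only [hgh s (mem_Ioi.1 hs).le]) measurableSet_Ioi
  have hint : IntegrableOn (fun s => (g s)⁻¹) (Ioi 1) := by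
    refine Integrable.mono' hint' hginv.aestronglyMeasurable
      ((ae_restrict_iff' measurableSet_Ioi).2 (Eventually.of_forall fun s hs => ?_))
    rw [Real.norm_of_nonneg (inv_pos.2 (hgpos s)).le, div_eq_mul_inv]
    exact le_mul_of_one_le_left (inv_pos.2 (hgpos s)).le (mem_Ioi.1 hs).le
  have hunb := exists_le_integral_Ioi_of_eq_const (a := 1) (inv_pos.2 (hgpos 1))
    (hginv.integrableOn_Ioi_of_integrableOn_Ioi hint)
    (setIntegral_nonneg measurableSet_Ioi fun s _ => (inv_pos.2 (hgpos s)).le)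
    fun s hs => by simp only [g, max_eq_right hs, max_self]
  have hF : ∀ τ : ℝ, 1 ≤ τ → ∫ s in Ici τ, (h s)⁻¹ = ∫ s in Ioi τ, (g s)⁻¹ := fun τ hτ => by
    rw [integral_Ici_eq_integral_Ioi]
    exact setIntegral_congr_fun measurableSet_Ioi fun s hs => by
      simp only [hgh s (hτ.trans (mem_Ioi.1 hs).le)]
  have hanti : StrictAnti fun x => ∫ s in Ioi x, (g s)⁻¹ := strictAnti_of_deriv_neg fun x => by
    rw [(hginv.hasDerivAt_integral_Ioi hint x).deriv]
    exact neg_neg_of_pos (inv_pos.2 (hgpos x))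
  obtain ⟨χ, G, hχ0, hχc, hχG, hGtop⟩ := exists_hasDerivAt_eq_neg_comp hg hgpos hint hint' hunb
  rw [hF 1 le_rfl]
  set T := ∫ s in Ioi (1 : ℝ), (g s)⁻¹
  have hderiv : EqOn (deriv χ) G (Ioi 0) := fun t ht => (hχG t ht).1.deriv
  have hG1 : ∀ t ∈ Ioc 0 T, 1 ≤ G t := fun t ht =>
    hanti.le_iff_ge.1 ((hχG t ht.1).2.2.trans_le ht.2)
  have hcont : ContinuousOn χ (Icc 0 T) := fun t ht => by
    rcases ht.1.eq_or_lt with rfl | h0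
    · exact hχc.mono Icc_subset_Ici_self
    · exact (hχG t h0).1.continuousAt.continuousWithinAt
  have hC2 : ContDiffOn ℝ 2 χ (Ioi 0) := by
    have hG2 : ContDiffOn ℝ 1 G (Ioi 0) := by
      rw [show (1 : WithTop ℕ∞) = 0 + 1 by norm_num, contDiffOn_succ_iff_deriv_of_isOpen isOpen_Ioi]
      refine ⟨fun t ht => (hχG t ht).2.1.differentiableAt.differentiableWithinAt, by simp, ?_⟩
      refine contDiffOn_zero.2 (ContinuousOn.congr (f := fun t => -g (G t)) ?_
        fun t ht => (hχG t ht).2.1.deriv)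
      exact (hg.comp_continuousOn fun t ht =>
        (hχG t ht).2.1.continuousAt.continuousWithinAt).neg
    rw [show (2 : WithTop ℕ∞) = 1 + 1 by norm_num, contDiffOn_succ_iff_deriv_of_isOpen isOpen_Ioi]
    exact ⟨fun t ht => (hχG t ht).1.differentiableAt.differentiableWithinAt, by simp,
      hG2.congr hderiv⟩
  refine ⟨?_, χ, hcont, hC2.mono Ioc_subset_Ioi_self, hχ0, ?_, ?_, fun t ht => ?_, fun t ht => ?_⟩
  · exact (setIntegral_nonneg measurableSet_Ioi fun s _ => (inv_pos.2 (hgpos s)).le).trans_lt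
      (hanti (lt_add_one 1))
  · refine strictMonoOn_of_deriv_pos (convex_Icc 0 T) hcont fun t ht => ?_
    rw [interior_Icc] at ht
    rw [hderiv ht.1]
    exact zero_lt_one.trans_le (hG1 t (Ioo_subset_Ioc_self ht))
  · exact hGtop.congr' (hderiv.symm.eventuallyEq_of_mem self_mem_nhdsWithin)
  · rw [hderiv ht.1, (hderiv.eventuallyEq_of_mem (Ioi_mem_nhds ht.1)).deriv_eq,
      (hχG t ht.1).2.1.deriv, hgh _ (hG1 t ht)]
  · rw [hderiv ht.1]
    exact ⟨hG1 t ht, (hF _ (hG1 t ht)).trans (hχG t ht.1).2.2⟩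
end
end
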